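/- All long simple roots of Φ lie in a single connected component of H(Φ_long^+); that is, H(Φ_long^+) has a unique connected component containing vertices corresponding to long simple roots. -/

import Mathlib

noncomputable section

namespace Paper

/-- The root lattice of rank `l`, with coordinates taken in the basis of simple roots. -/
abbrev RL (l : ℕ) := Fin l → ℤ

/-- The `i`-th simple root `αᵢ`. -/
def sroot (l : ℕ) (i : Fin l) : RL l := Pi.single i 1

/-- The Cartan pairing `⟨v, αᵢ^∨⟩` attached to a Cartan matrix `A`,
with the convention `A i j = ⟨αⱼ, αᵢ^∨⟩`. -/
def cmPair (l : ℕ) (A : Matrix (Fin l) (Fin l) ℤ) (v : RL l) (i : Fin l) : ℤ :=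
  ∑ j, A i j * v j

/-- The closure of a set `S0` of root-lattice vectors under all simple reflections
(computed with respect to the Cartan matrix `A`). -/
def orbitOf (l : ℕ) (A : Matrix (Fin l) (Fin l) ℤ) (S0 : Set (RL l)) : Set (RL l) :=
  ⋂₀ {T | S0 ⊆ T ∧ ∀ v ∈ T, ∀ i : Fin l, v - cmPair l A v i • sroot l i ∈ T}

/-- The set `Φ` of roots of the root system with Cartan matrix `A`:
the orbit of the simple roots under the Weyl group. -/
def rootsOf (l : ℕ) (A : Matrix (Fin l) (Fin l) ℤ) : Set (RL l) :=
  orbitOf l A {v | ∃ i, v = sroot l i}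

/-- The set `Φ⁺` of positive roots. -/
def posRoots (l : ℕ) (A : Matrix (Fin l) (Fin l) ℤ) : Set (RL l) :=
  {v ∈ rootsOf l A | ∀ i, 0 ≤ v i}

/-- The (suitably scaled) squared length `⟨v, v⟩` with respect to the symmetrizer `d`
(`d i` represents half the squared length of `αᵢ`). -/
def nsq (l : ℕ) (A : Matrix (Fin l) (Fin l) ℤ) (d : Fin l → ℤ) (v : RL l) : ℤ :=
  ∑ i, ∑ j, d i * A i j * v i * v j

/-- The set of roots of squared length `c`. -/
def lenSet (l : ℕ) (A : Matrix (Fin l) (Fin l) ℤ) (d : Fin l → ℤ) (c : ℤ) : Set (RL l) :=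
  {v ∈ rootsOf l A | nsq l A d v = c}

/-- The set of positive roots of squared length `c`. -/
def posLen (l : ℕ) (A : Matrix (Fin l) (Fin l) ℤ) (d : Fin l → ℤ) (c : ℤ) : Set (RL l) :=
  {v ∈ lenSet l A d c | ∀ i, 0 ≤ v i}

/-! Cartan matrices (Bourbaki numbering, shifted to be 0-indexed);
the convention is `A i j = ⟨αⱼ, αᵢ^∨⟩`. -/

/-- The Cartan matrix of type `A_l`. -/
def CM_A (l : ℕ) : Matrix (Fin l) (Fin l) ℤ := Matrix.of fun i j =>
  if i = j then 2 else if (i : ℕ) + 1 = (j : ℕ) ∨ (j : ℕ) + 1 = (i : ℕ) then -1 else 0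

/-- The Cartan matrix of type `B_l` (the last simple root is short). -/
def CM_B (l : ℕ) : Matrix (Fin l) (Fin l) ℤ := Matrix.of fun i j =>
  if i = j then 2
  else if (i : ℕ) = (j : ℕ) + 1 then (if (i : ℕ) = l - 1 then -2 else -1)
  else if (j : ℕ) = (i : ℕ) + 1 then -1 else 0

/-- The Cartan matrix of type `C_l` (the last simple root is long). -/
def CM_C (l : ℕ) : Matrix (Fin l) (Fin l) ℤ := Matrix.of fun i j =>
  if i = j then 2
  else if (j : ℕ) = (i : ℕ) + 1 then (if (j : ℕ) = l - 1 then -2 else -1)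
  else if (i : ℕ) = (j : ℕ) + 1 then -1 else 0

/-- The Cartan matrix of type `D_l`. -/
def CM_D (l : ℕ) : Matrix (Fin l) (Fin l) ℤ := Matrix.of fun i j =>
  if i = j then 2
  else if ((i : ℕ) + 1 = (j : ℕ) ∧ (j : ℕ) + 1 ≤ l - 1) ∨
          ((j : ℕ) + 1 = (i : ℕ) ∧ (i : ℕ) + 1 ≤ l - 1) ∨
          ((i : ℕ) = l - 3 ∧ (j : ℕ) = l - 1) ∨ ((j : ℕ) = l - 3 ∧ (i : ℕ) = l - 1) then -1
  else 0

/-- The Cartan matrix of type `E_l` (`l ∈ {6,7,8}`). -/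
def CM_E (l : ℕ) : Matrix (Fin l) (Fin l) ℤ := Matrix.of fun i j =>
  if i = j then 2
  else if ((i : ℕ) = 0 ∧ (j : ℕ) = 2) ∨ ((j : ℕ) = 0 ∧ (i : ℕ) = 2) ∨
          ((i : ℕ) = 1 ∧ (j : ℕ) = 3) ∨ ((j : ℕ) = 1 ∧ (i : ℕ) = 3) ∨
          (2 ≤ (i : ℕ) ∧ (j : ℕ) = (i : ℕ) + 1) ∨
          (2 ≤ (j : ℕ) ∧ (i : ℕ) = (j : ℕ) + 1) then -1
  else 0

/-- The Cartan matrix of type `F₄` (used with `l = 4`; `α₁, α₂` long, `α₃, α₄` short). -/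
def CM_F4 (l : ℕ) : Matrix (Fin l) (Fin l) ℤ := Matrix.of fun i j =>
  if i = j then 2
  else if ((i : ℕ) = 0 ∧ (j : ℕ) = 1) ∨ ((j : ℕ) = 0 ∧ (i : ℕ) = 1) ∨
          ((i : ℕ) = 1 ∧ (j : ℕ) = 2) ∨
          ((i : ℕ) = 2 ∧ (j : ℕ) = 3) ∨ ((j : ℕ) = 2 ∧ (i : ℕ) = 3) then -1
  else if (i : ℕ) = 2 ∧ (j : ℕ) = 1 then -2 else 0

/-- The Cartan matrix of type `G₂` (used with `l = 2`; `α₁` short, `α₂` long). -/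
def CM_G2 (l : ℕ) : Matrix (Fin l) (Fin l) ℤ := Matrix.of fun i j =>
  if i = j then 2
  else if (i : ℕ) = 0 ∧ (j : ℕ) = 1 then -3
  else if (i : ℕ) = 1 ∧ (j : ℕ) = 0 then -1 else 0

/-! Symmetrizers: `d i` is half the squared length of `αᵢ`, scaled so that short
roots have squared length `2` and long roots have squared length `4` (resp. `6` in
type `G₂`). -/

/-- Symmetrizer for type `B_l`. -/
def dB (l : ℕ) : Fin l → ℤ := fun i => if (i : ℕ) = l - 1 then 1 else 2
/-- Symmetrizer for type `C_l`. -/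
def dC (l : ℕ) : Fin l → ℤ := fun i => if (i : ℕ) = l - 1 then 2 else 1
/-- Symmetrizer for type `F₄`. -/
def dF4 (l : ℕ) : Fin l → ℤ := fun i => if (i : ℕ) ≤ 1 then 2 else 1
/-- Symmetrizer for type `G₂`. -/
def dG2 (l : ℕ) : Fin l → ℤ := fun i => if (i : ℕ) = 0 then 1 else 3

/-- Adjacency in (the underlying undirected graph of) the Hasse diagram of a set `P`
of positive roots: two vertices of `P` are joined iff they differ by a simple root. -/
def hstep (l : ℕ) (P : Set (RL l)) (v w : RL l) : Prop :=
  v ∈ P ∧ w ∈ P ∧ ∃ i : Fin l, w = v + sroot l i ∨ v = w + sroot l i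

/-- Connectivity (reachability) in the Hasse diagram of `P`. -/
def hconn (l : ℕ) (P : Set (RL l)) : RL l → RL l → Prop :=
  Relation.ReflTransGen (hstep l P)

/-- The connected component `𝒞₀` of the Hasse diagram `H(Φ_long⁺)` of long positive
roots which contains the long simple roots (long = squared length `4` here; this is
used for types `B`, `C`, `F₄`). -/
def C0 (l : ℕ) (A : Matrix (Fin l) (Fin l) ℤ) (d : Fin l → ℤ) : Set (RL l) :=
  {v | ∃ i : Fin l, sroot l i ∈ lenSet l A d 4 ∧ hconn l (posLen l A d 4) (sroot l i) v}

lemma sroot_mem_rootsOf (l : ℕ) (A : Matrix (Fin l) (Fin l) ℤ) (i : Fin l) :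
    sroot l i ∈ rootsOf l A :=
  fun _ hT => hT.1 ⟨i, rfl⟩

lemma reflection_mem_rootsOf {l : ℕ} {A : Matrix (Fin l) (Fin l) ℤ} {v : RL l}
    (hv : v ∈ rootsOf l A) (i : Fin l) :
    v - cmPair l A v i • sroot l i ∈ rootsOf l A :=
  fun T hT => hT.2 v (hv T hT) i

lemma cmPair_sroot (l : ℕ) (A : Matrix (Fin l) (Fin l) ℤ) (i j : Fin l) :
    cmPair l A (sroot l i) j = A j i := by
  simp [cmPair, sroot, Pi.single_apply]

lemma nsq_sroot (l : ℕ) (A : Matrix (Fin l) (Fin l) ℤ) (d : Fin l → ℤ) (i : Fin l) :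
    nsq l A d (sroot l i) = d i * A i i := by
  simp [nsq, sroot, Pi.single_apply]

lemma nsq_sroot_add_sroot (l : ℕ) (A : Matrix (Fin l) (Fin l) ℤ) (d : Fin l → ℤ)
    (i j : Fin l) :
    nsq l A d (sroot l i + sroot l j) =
      d i * A i i + d i * A i j + d j * A j i + d j * A j j := by
  simp [nsq, sroot, Pi.single_apply, mul_add, Finset.sum_add_distrib]
  ring

lemma sroot_nonneg (l : ℕ) (i k : Fin l) : 0 ≤ sroot l i k := by
  unfold sroot
  rw [Pi.single_apply]
  split_ifs <;> simp

lemma sroot_mem_posLen {l : ℕ} {A : Matrix (Fin l) (Fin l) ℤ} {d : Fin l → ℤ} {c : ℤ}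
    {i : Fin l} (h : sroot l i ∈ lenSet l A d c) : sroot l i ∈ posLen l A d c :=
  ⟨h, sroot_nonneg l i⟩

lemma hconn_symm {l : ℕ} {P : Set (RL l)} {v w : RL l} (h : hconn l P v w) :
    hconn l P w v :=
  have : Std.Symm (hstep l P) := ⟨fun _ _ ⟨hx, hy, k, hk⟩ => ⟨hy, hx, k, hk.symm⟩⟩
  Relation.ReflTransGen.stdSymm.symm _ _ h

/-- Two simple roots of the same length joined by a simple bond are connected through
their sum. -/
lemma hconn_sroot_of_bond {l : ℕ} {A : Matrix (Fin l) (Fin l) ℤ} {d : Fin l → ℤ} {c : ℤ}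
    {i j : Fin l} (hi : sroot l i ∈ lenSet l A d c) (hj : sroot l j ∈ lenSet l A d c)
    (hij : A i j = -1) (hji : A j i = -1) (hd : d i + d j = c) :
    hconn l (posLen l A d c) (sroot l i) (sroot l j) := by
  have hroot : sroot l i + sroot l j ∈ rootsOf l A := by
    simpa [cmPair_sroot, hji] using reflection_mem_rootsOf (sroot_mem_rootsOf l A i) j
  have hni := hi.2
  have hnj := hj.2
  rw [nsq_sroot] at hni hnj
  have hsum : sroot l i + sroot l j ∈ posLen l A d c := by
    refine ⟨⟨hroot, ?_⟩, fun k => add_nonneg (sroot_nonneg l i k) (sroot_nonneg l j k)⟩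
    rw [nsq_sroot_add_sroot, hij, hji]
    linarith
  exact (Relation.ReflTransGen.single
      ⟨sroot_mem_posLen hi, hsum, j, Or.inl rfl⟩).tail
    ⟨hsum, sroot_mem_posLen hj, i, Or.inr (add_comm _ _)⟩

lemma sroot_mem_lenSet_CM_B_iff (l : ℕ) (i : Fin l) :
    sroot l i ∈ lenSet l (CM_B l) (dB l) 4 ↔ (i : ℕ) ≠ l - 1 := by
  have h : sroot l i ∈ lenSet l (CM_B l) (dB l) 4 ↔ nsq l (CM_B l) (dB l) (sroot l i) = 4 :=
    and_iff_right (sroot_mem_rootsOf l _ i)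
  rw [h, nsq_sroot]
  by_cases hi : (i : ℕ) = l - 1 <;> simp [CM_B, dB, hi]

lemma hconn_sroot_zero_CM_B {l : ℕ} (hl : 2 ≤ l) (k : ℕ) (hk : k < l - 1) :
    hconn l (posLen l (CM_B l) (dB l) 4) (sroot l ⟨0, by omega⟩)
      (sroot l ⟨k, by omega⟩) := by
  induction k with
  | zero => exact Relation.ReflTransGen.refl
  | succ k ih =>
    refine (ih (by omega)).trans (hconn_sroot_of_bond ?_ ?_ ?_ ?_ ?_)
    · exact (sroot_mem_lenSet_CM_B_iff l _).2 (by simp only; omega)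
    · exact (sroot_mem_lenSet_CM_B_iff l _).2 (by simp only; omega)
    · simp [CM_B]
      omega
    · simp [CM_B, hk.ne]
    · have : k ≠ l - 1 := by omega
      simp [dB, hk.ne, this]

/-- In types `B_l (l ≥ 2)`, `C_l (l ≥ 2)`, `F₄` and `G₂`, all long
simple roots lie in a single connected component of `H(Φ_long⁺)`. -/
theorem long_simples_in_one_component :
    (∀ l : ℕ, 2 ≤ l → ∀ i j : Fin l,
      sroot l i ∈ lenSet l (CM_B l) (dB l) 4 → sroot l j ∈ lenSet l (CM_B l) (dB l) 4 →
      hconn l (posLen l (CM_B l) (dB l) 4) (sroot l i) (sroot l j)) ∧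
    (∀ l : ℕ, 2 ≤ l → ∀ i j : Fin l,
      sroot l i ∈ lenSet l (CM_C l) (dC l) 4 → sroot l j ∈ lenSet l (CM_C l) (dC l) 4 →
      hconn l (posLen l (CM_C l) (dC l) 4) (sroot l i) (sroot l j)) ∧
    (∀ i j : Fin 4,
      sroot 4 i ∈ lenSet 4 (CM_F4 4) (dF4 4) 4 → sroot 4 j ∈ lenSet 4 (CM_F4 4) (dF4 4) 4 →
      hconn 4 (posLen 4 (CM_F4 4) (dF4 4) 4) (sroot 4 i) (sroot 4 j)) ∧
    (∀ i j : Fin 2,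
      sroot 2 i ∈ lenSet 2 (CM_G2 2) (dG2 2) 6 → sroot 2 j ∈ lenSet 2 (CM_G2 2) (dG2 2) 6 →
      hconn 2 (posLen 2 (CM_G2 2) (dG2 2) 6) (sroot 2 i) (sroot 2 j)) := by
  refine ⟨fun l hl i j hi hj => ?_, fun l _ i j hi hj => ?_, fun i j hi hj => ?_,
    fun i j hi hj => ?_⟩
  · rw [sroot_mem_lenSet_CM_B_iff] at hi hj
    exact (hconn_symm (hconn_sroot_zero_CM_B hl i (by omega))).trans
      (hconn_sroot_zero_CM_B hl j (by omega))
  · have last : ∀ k : Fin l, sroot l k ∈ lenSet l (CM_C l) (dC l) 4 → (k : ℕ) = l - 1 := by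
      intro k hk
      have hn := hk.2
      rw [nsq_sroot] at hn
      by_contra h
      simp [CM_C, dC, h] at hn
    obtain rfl : i = j := Fin.ext ((last i hi).trans (last j hj).symm)
    exact Relation.ReflTransGen.refl
  · have hni := hi.2
    have hnj := hj.2
    rw [nsq_sroot] at hni hnj
    fin_cases i <;> fin_cases j <;>
      first
      | exact Relation.ReflTransGen.refl
      | exact hconn_sroot_of_bond hi hj (by decide) (by decide) (by decide)
      | exact absurd hni (by decide)
      | exact absurd hnj (by decide)
  · have hni := hi.2
    have hnj := hj.2
    rw [nsq_sroot] at hni hnj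
    fin_cases i <;> fin_cases j <;>
      first
      | exact Relation.ReflTransGen.refl
      | exact absurd hni (by decide)
      | exact absurd hnj (by decide)

end Paper

end
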